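/- Let k be an integer with 1 ≤ k ≤ q−2 (so q ≥ 3). Then the set of polynomials f ∈ S(V) satisfying det(g)^k (g·f) = f for all g ∈ P_I equals (θ_1θ_2⋯θ_ℓ)^{q−1−k} · S(V)^{P_I}; in other words, (S(V)⊗Det^k)^{P_I} is a free S(V)^{P_I}-module of rank 1 generated by (θ_1θ_2⋯θ_ℓ)^{q−1−k}. -/

import Mathlib

open scoped TensorProduct
open MvPolynomial Finset

noncomputable section

/-- The symmetric algebra `S(V) = F[x_1,…,x_n]` of the natural module `V = F^n`. -/
abbrev SV (F : Type) [Field F] (n : ℕ) := MvPolynomial (Fin n) F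

/-- The exterior algebra `Λ(V) = E[y_1,…,y_n]`. -/
abbrev LV (F : Type) [Field F] (n : ℕ) := ExteriorAlgebra F (Fin n → F)

/-- `S(V) ⊗ Λ(V)`. -/
abbrev SL (F : Type) [Field F] (n : ℕ) := SV F n ⊗[F] LV F n

/-- the variable `x_{a+1}` (0-indexed `a`), junk value `0` out of range. -/
def xV (F : Type) [Field F] (n a : ℕ) : SV F n :=
  if h : a < n then X ⟨a, h⟩ else 0

/-- the exterior generator `y_{a+1}` (0-indexed `a`). -/
def yV (F : Type) [Field F] (n a : ℕ) : LV F n :=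
  if h : a < n then ExteriorAlgebra.ι F (Pi.single (⟨a, h⟩ : Fin n) (1 : F)) else 0

/-- the product `y_{s_1} ⋯ y_{s_j}` over `S = {s_1 < ⋯ < s_j}` in increasing order. -/
def yProd (F : Type) [Field F] (n : ℕ) (S : Finset ℕ) : LV F n :=
  ((S.sort (· ≤ ·)).map (yV F n)).prod

/-- determinant of the matrix `(x_t^{q^c})` with rows indexed by `c ∈ R` in increasing
order and columns by `t ∈ C` in increasing order; junk value `0` if sizes differ. -/
def subDet (F : Type) [Field F] (q n : ℕ) (R C : Finset ℕ) : SV F n :=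
  if h : C.card = R.card then
    Matrix.det (Matrix.of fun i j : Fin R.card =>
      xV F n (C.orderEmbOfFin h j) ^ q ^ (R.orderEmbOfFin rfl i : ℕ))
  else 0

/-- Mui's element `M_{m;b_1,…,b_j}` where `B = {b_1 < ⋯ < b_j}` (0-indexed `b`'s);
for `B = ∅` this is the Moore determinant `det (x_t^{q^c})`. -/
def MuiM (F : Type) [Field F] (q n m : ℕ) (B : Finset ℕ) : SL F n :=
  ∑ S ∈ (range m).powersetCard B.card,
    ((-1 : F) ^ (B.card * (B.card + 1) / 2 + (∑ s ∈ S, s) + B.card)) •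
      (subDet F q n (range m \ B) (range m \ S) ⊗ₜ[F] yProd F n S)

/-- `∏_{c : F^a} (c_1 x_1 + ⋯ + c_a x_a + x_{t+1})` (0-indexed `t`). -/
def linProd (F : Type) [Field F] [Fintype F] (n a t : ℕ) : SV F n :=
  ∏ c : Fin a → F, ((∑ k : Fin a, MvPolynomial.C (c k) * xV F n k) + xV F n t)

/-- Dickson's `L_m = V_1 V_2 ⋯ V_m`. -/
def Lm (F : Type) [Field F] [Fintype F] (n m : ℕ) : SV F n :=
  ∏ a ∈ range m, linProd F n a a

/-- The property characterizing the Dickson invariants `Q_{m,k}`: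
`Q_{m,k} · L_m = L_{m,k}` in `F[x_1,…,x_m]`. -/
def DicksonProp (F : Type) [Field F] [Fintype F] (q : ℕ)
    (Q : (m : ℕ) → ℕ → SV F m) : Prop :=
  ∀ m k : ℕ, k ≤ m →
    Q m k * Lm F m m = subDet F q m (range (m + 1) \ {k}) (range m)

/-- action of a matrix on `S(V)` by linear substitution: `x_j ↦ ∑_i g_{ij} x_i`. -/
def gAct (F : Type) [Field F] (n : ℕ) (g : Matrix (Fin n) (Fin n) F) :
    SV F n →ₐ[F] SV F n :=
  MvPolynomial.aeval fun j => ∑ i, MvPolynomial.C (g i j) * MvPolynomial.X i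

/-- action of a matrix on `Λ(V)` by linear substitution: `y_j ↦ ∑_i g_{ij} y_i`. -/
def eAct (F : Type) [Field F] (n : ℕ) (g : Matrix (Fin n) (Fin n) F) :
    LV F n →ₐ[F] LV F n :=
  ExteriorAlgebra.map g.mulVecLin

/-- diagonal action of a matrix on `S(V) ⊗ Λ(V)`. -/
def tAct (F : Type) [Field F] (n : ℕ) (g : Matrix (Fin n) (Fin n) F) :
    SL F n →ₐ[F] SL F n :=
  Algebra.TensorProduct.map (gAct F n g) (eAct F n g)

/-- the invariants of a set of matrices on `S(V) ⊗ Λ(V)`, as an `F`-subspace. -/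
def invSL (F : Type) [Field F] (n : ℕ) (P : Set (Matrix (Fin n) (Fin n) F)) :
    Submodule F (SL F n) where
  carrier := {f | ∀ g ∈ P, tAct F n g f = f}
  add_mem' := fun ha hb g hg => by rw [map_add, ha g hg, hb g hg]
  zero_mem' := fun g hg => map_zero _
  smul_mem' := fun c f hf g hg => by rw [map_smul, hf g hg]

/-- the invariants of `S(V) ⊗ Λ(V) ⊗ Det^k`, i.e. elements with
`det(g)^k (g·f) = f` for all `g ∈ P`. -/
def invSLtw (F : Type) [Field F] (n k : ℕ) (P : Set (Matrix (Fin n) (Fin n) F)) :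
    Submodule F (SL F n) where
  carrier := {f | ∀ g ∈ P, g.det ^ k • tAct F n g f = f}
  add_mem' := fun ha hb g hg => by rw [map_add, smul_add, ha g hg, hb g hg]
  zero_mem' := fun g hg => by rw [map_zero, smul_zero]
  smul_mem' := fun c f hf g hg => by rw [map_smul, smul_comm, hf g hg]

/-- the invariants of a set of matrices on `S(V)`, as an `F`-subalgebra. -/
def invS (F : Type) [Field F] (n : ℕ) (P : Set (Matrix (Fin n) (Fin n) F)) :
    Subalgebra F (SV F n) where
  carrier := {f | ∀ g ∈ P, gAct F n g f = f}
  mul_mem' := fun ha hb g hg => by rw [map_mul, ha g hg, hb g hg]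
  one_mem' := fun g hg => map_one _
  add_mem' := fun ha hb g hg => by rw [map_add, ha g hg, hb g hg]
  zero_mem' := fun g hg => map_zero _
  algebraMap_mem' := fun c g hg => (gAct F n g).commutes c

/-- `v_{i,j+1}` (0-indexed `j`) for the composition `I`. -/
def vij (F : Type) [Field F] [Fintype F] (n : ℕ) (I : Composition n)
    (i : Fin I.length) (j : ℕ) : SV F n :=
  linProd F n (I.sizeUpTo i) (I.sizeUpTo i + j)

/-- `θ_i = L_{n_i}(v_{i,1},…,v_{i,n_i})`. -/
def theta (F : Type) [Field F] [Fintype F] (n : ℕ) (I : Composition n)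
    (i : Fin I.length) : SV F n :=
  MvPolynomial.aeval (fun t : Fin (I.blocksFun i) => vij F n I i t)
    (Lm F (I.blocksFun i) (I.blocksFun i))

/-- `q_{i,k} = Q_{n_i,k}(v_{i,1},…,v_{i,n_i})`, given the Dickson polynomials `Q`. -/
def qInv (F : Type) [Field F] [Fintype F] (n : ℕ) (Q : (m : ℕ) → ℕ → SV F m)
    (I : Composition n) (i : Fin I.length) (k : ℕ) : SV F n :=
  MvPolynomial.aeval (fun t : Fin (I.blocksFun i) => vij F n I i t)
    (Q (I.blocksFun i) k)

/-- the index of the block (0-indexed) of the composition `I` containing `a`. -/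
def blkIdx (n : ℕ) (I : Composition n) (a : ℕ) : ℕ :=
  ((range I.length).filter fun i => I.sizeUpTo (i + 1) ≤ a).card

/-- the parabolic subgroup `P_I`: invertible block upper-triangular matrices. -/
def PIset (F : Type) [Field F] (n : ℕ) (I : Composition n) :
    Set (Matrix (Fin n) (Fin n) F) :=
  {g | IsUnit g.det ∧ ∀ a b : Fin n, blkIdx n I b < blkIdx n I a → g a b = 0}

/-- the subgroup `K_I ≤ P_I`: block upper-triangular with all diagonal blocks
of determinant `1`. -/
def KIset (F : Type) [Field F] (n : ℕ) (I : Composition n) :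
    Set (Matrix (Fin n) (Fin n) F) :=
  {g | IsUnit g.det ∧ (∀ a b : Fin n, blkIdx n I b < blkIdx n I a → g a b = 0) ∧
    ∀ i : Fin I.length,
      Matrix.det (Matrix.of fun a b : Fin (I.blocksFun i) =>
        g (I.embedding i a) (I.embedding i b)) = 1}

/-- the unipotent subgroup `U_n` of uni-uppertriangular matrices. -/
def Uset (F : Type) [Field F] (n : ℕ) : Set (Matrix (Fin n) (Fin n) F) :=
  {g | (∀ a b : Fin n, b < a → g a b = 0) ∧ ∀ a : Fin n, g a a = 1}

/-- `SL_n(q)`. -/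
def SLset (F : Type) [Field F] (n : ℕ) : Set (Matrix (Fin n) (Fin n) F) :=
  {g | g.det = 1}

/-- `GL_n(q)`. -/
def GLset (F : Type) [Field F] (n : ℕ) : Set (Matrix (Fin n) (Fin n) F) :=
  {g | IsUnit g.det}

/-- the bigraded piece `S^i(V) ⊗ Λ^j(V)` of `S(V) ⊗ Λ(V)`. -/
def piece (F : Type) [Field F] (n i j : ℕ) : Submodule F (SL F n) :=
  LinearMap.range (TensorProduct.map
    (MvPolynomial.homogeneousSubmodule (Fin n) F i).subtype
    (LinearMap.range (ExteriorAlgebra.ι F (M := Fin n → F)) ^ j).subtype)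

/-- the Hilbert series in `ℤ[s][[t]]` of a bigraded subspace `W` of `S(V) ⊗ Λ(V)`:
the coefficient of `t^i` is `∑_{j=0}^n dim (W ∩ (S^i ⊗ Λ^j)) s^j`. -/
def Hser (F : Type) [Field F] (n : ℕ) (W : Submodule F (SL F n)) :
    PowerSeries (Polynomial ℤ) :=
  PowerSeries.mk fun i => ∑ j ∈ range (n + 1),
    Polynomial.C (Module.finrank F ↥(W ⊓ piece F n i j) : ℤ) * Polynomial.X ^ j

/-- the Hilbert series in `ℤ[[t]]` of a graded subalgebra of `S(V)`. -/
def HserS (F : Type) [Field F] (n : ℕ) (W : Subalgebra F (SV F n)) :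
    PowerSeries ℤ :=
  PowerSeries.mk fun d =>
    (Module.finrank F ↥(Subalgebra.toSubmodule W ⊓ MvPolynomial.homogeneousSubmodule (Fin n) F d) : ℤ)

/-- the index set for Mui-type basis elements attached to the composition `I`:
pairs `(i, B)` with `B = {b_1 < ⋯ < b_j} ⊆ {0,…,m_{i+1}−1}` nonempty and
`max B ≥ m_i` (0-indexed `i`). -/
def Adm (n : ℕ) (I : Composition n) : Finset (Fin I.length × Finset ℕ) :=
  (Finset.univ ×ˢ (range n).powerset).filter fun x =>
    x.2 ⊆ range (I.sizeUpTo ((x.1 : ℕ) + 1)) ∧ x.2.Nonempty ∧ ∃ b ∈ x.2, I.sizeUpTo (x.1 : ℕ) ≤ b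

section ParabolicInvariants

variable {F : Type} [Field F] {n : ℕ}

/-- The linear form `∑ v_i x_i` with coefficient vector `v`. -/
def linForm (v : Fin n → F) : SV F n := ∑ i, MvPolynomial.C (v i) * X i

/-- The vector with last nonzero coordinate `1` in position `t.1`, preceded by the entries `t.2`. -/
def monicVec (t : Σ a : Fin n, (Fin a → F)) : Fin n → F := fun k =>
  if h : k < t.1 then t.2 ⟨k, h⟩ else if k = t.1 then 1 else 0

lemma linForm_smul (c : F) (v : Fin n → F) :
    linForm (c • v) = MvPolynomial.C c * linForm v := by
  simp [linForm, Finset.mul_sum, mul_assoc]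

lemma linForm_single (a : Fin n) (t : F) :
    linForm (Pi.single a t) = MvPolynomial.C t * X a := by
  rw [linForm, Finset.sum_eq_single a]
  · simp
  · intro b _ hb
    simp [hb]
  · simp

lemma coeff_linForm (v : Fin n → F) (a : Fin n) :
    coeff (Finsupp.single a 1) (linForm v) = v a := by
  simp [linForm, coeff_sum, coeff_C_mul, coeff_X, Finsupp.single_left_inj]

lemma linForm_add_eq (a : Fin n) (c : Fin a → F) :
    (∑ k : Fin a, MvPolynomial.C (c k) * xV F n k) + xV F n a = linForm (monicVec ⟨a, c⟩) := by
  set G : ℕ → SV F n := fun k =>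
    MvPolynomial.C (if h : k < a then c ⟨k, h⟩ else if k = a then 1 else 0) * xV F n k with hG
  have h1 : linForm (monicVec ⟨a, c⟩) = ∑ i : Fin n, G i := by
    refine Finset.sum_congr rfl fun i _ => ?_
    simp [hG, monicVec, xV, Fin.ext_iff]
  have h2 : ∑ k ∈ range (a + 1), G k = ∑ k ∈ range n, G k := by
    refine Finset.sum_subset (by simp) fun k _ hk => ?_
    have : ¬ k < a ∧ k ≠ a := by simp at hk; omega
    simp [hG, this]
  rw [h1, ← Finset.sum_range, ← h2, Finset.sum_range_succ, Finset.sum_range]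
  simp [hG]

lemma linProd_eq [Fintype F] (a : Fin n) :
    linProd F n a a = ∏ c : Fin a → F, linForm (monicVec ⟨a, c⟩) :=
  Finset.prod_congr rfl fun c _ => linForm_add_eq a c

lemma Lm_eq [Fintype F] :
    Lm F n n = ∏ t : (Σ a : Fin n, (Fin a → F)), linForm (monicVec t) := by
  rw [Lm, Finset.prod_range, Fintype.prod_sigma]
  exact Finset.prod_congr rfl fun a _ => linProd_eq a

lemma monicVec_self (t : Σ a : Fin n, (Fin a → F)) : monicVec t t.1 = 1 := by
  simp [monicVec]

lemma monicVec_of_lt (t : Σ a : Fin n, (Fin a → F)) {b : Fin n} (h : t.1 < b) :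
    monicVec t b = 0 := by
  simp [monicVec, h.le, h.ne']

lemma monicVec_ne_zero (t : Σ a : Fin n, (Fin a → F)) : monicVec t ≠ 0 := fun h => by
  simpa [monicVec_self] using congrFun h t.1

lemma eq_of_monicVec_eq_smul {s t : Σ a : Fin n, (Fin a → F)} {c : F}
    (h : monicVec s = c • monicVec t) : s = t := by
  have hc : c ≠ 0 := by
    rintro rfl
    exact monicVec_ne_zero s (by simpa using h)
  have h1 : s.1 = t.1 := by
    rcases lt_trichotomy s.1 t.1 with hl | he | hl
    · have := congrFun h t.1
      simp [monicVec_self, monicVec_of_lt s hl] at this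
      exact absurd this.symm hc
    · exact he
    · have := congrFun h s.1
      simp [monicVec_self, monicVec_of_lt t hl] at this
  obtain ⟨a, u⟩ := s
  obtain ⟨b, w⟩ := t
  obtain rfl : a = b := h1
  have hc1 : c = 1 := by
    have := congrFun h a
    simpa [monicVec, eq_comm] using this
  subst hc1
  congr 1
  funext k
  have := congrFun h ⟨k, k.2.trans a.2⟩
  simpa [monicVec, Fin.lt_def] using this

lemma exists_eq_smul_monicVec {v : Fin n → F} (hv : v ≠ 0) :
    ∃ c : F, c ≠ 0 ∧ ∃ t, v = c • monicVec t := by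
  classical
  have hne : (univ.filter fun i => v i ≠ 0).Nonempty := by
    obtain ⟨i, hi⟩ := Function.ne_iff.mp hv
    exact ⟨i, by simpa using hi⟩
  obtain ⟨a, ha, hmax⟩ := (univ.filter fun i => v i ≠ 0).exists_max_image id hne
  have ha' : v a ≠ 0 := by simpa using ha
  refine ⟨v a, ha', ⟨a, fun k => (v a)⁻¹ * v ⟨k, k.2.trans a.2⟩⟩, ?_⟩
  funext k
  simp only [Pi.smul_apply, smul_eq_mul, monicVec]
  split_ifs with h1 h2
  · simp [ha']
  · simp [h2]
  · by_contra hk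
    have := hmax k (by simpa using hk)
    exact h2 (le_antisymm this (not_lt.mp h1))

lemma gAct_X (g : Matrix (Fin n) (Fin n) F) (j : Fin n) :
    gAct F n g (X j) = linForm fun i => g i j := by
  simp [gAct, linForm]

lemma gAct_linForm (g : Matrix (Fin n) (Fin n) F) (v : Fin n → F) :
    gAct F n g (linForm v) = linForm (g.mulVec v) := by
  have h : ∀ j, gAct F n g (MvPolynomial.C (v j) * X j) =
      ∑ i, MvPolynomial.C (g i j * v j) * X i := fun j => by
    rw [map_mul, gAct_X, linForm, Finset.mul_sum, ← algebraMap_eq, AlgHom.commutes]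
    exact Finset.sum_congr rfl fun i _ => by simp only [algebraMap_eq, map_mul]; ring
  rw [linForm, map_sum, Finset.sum_congr rfl fun j _ => h j, Finset.sum_comm, linForm]
  simp [Matrix.mulVec, dotProduct, Finset.sum_mul]

lemma gAct_mul (g h : Matrix (Fin n) (Fin n) F) (f : SV F n) :
    gAct F n (g * h) f = gAct F n g (gAct F n h f) := by
  have : gAct F n (g * h) = (gAct F n g).comp (gAct F n h) := by
    refine algHom_ext fun j => ?_
    rw [AlgHom.comp_apply, gAct_X, gAct_X, gAct_linForm]
    rfl
  rw [this]
  rfl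

lemma gAct_one (f : SV F n) : gAct F n 1 f = f := by
  have : gAct F n 1 = AlgHom.id F (SV F n) := by
    refine algHom_ext fun j => ?_
    rw [gAct_X, AlgHom.id_apply, ← one_mul (X j), ← C_1, ← linForm_single]
    congr 1
    funext i
    simp [Matrix.one_apply, Pi.single_apply]
  rw [this]
  rfl

/-- The automorphism of the symmetric algebra induced by an invertible matrix. -/
def gActEquiv (g : Matrix (Fin n) (Fin n) F) (hg : IsUnit g.det) : SV F n ≃ₐ[F] SV F n :=
  AlgEquiv.ofAlgHom (gAct F n g) (gAct F n g⁻¹)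
    (AlgHom.ext fun f => by
      rw [AlgHom.comp_apply, ← gAct_mul, Matrix.mul_nonsing_inv _ hg, gAct_one]; rfl)
    (AlgHom.ext fun f => by
      rw [AlgHom.comp_apply, ← gAct_mul, Matrix.nonsing_inv_mul _ hg, gAct_one]; rfl)

lemma gActEquiv_apply (g : Matrix (Fin n) (Fin n) F) (hg : IsUnit g.det) (f : SV F n) :
    gActEquiv g hg f = gAct F n g f := rfl

lemma gAct_dvd_iff (g : Matrix (Fin n) (Fin n) F) (hg : IsUnit g.det) (a b : SV F n) :
    gAct F n g a ∣ gAct F n g b ↔ a ∣ b :=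
  map_dvd_iff (gActEquiv g hg)

/-- The identity matrix with column `a` replaced by `v`. -/
def colMatrix (a : Fin n) (v : Fin n → F) : Matrix (Fin n) (Fin n) F :=
  (1 : Matrix (Fin n) (Fin n) F).updateCol a v

lemma det_colMatrix (a : Fin n) (v : Fin n → F) : (colMatrix a v).det = v a := by
  rw [colMatrix, ← Matrix.cramer_apply, Matrix.cramer_one]
  rfl

lemma gAct_colMatrix_X (a : Fin n) (v : Fin n → F) :
    gAct F n (colMatrix a v) (X a) = linForm v := by
  simp [gAct_X, colMatrix]

lemma gAct_colMatrix_X_of_ne {a b : Fin n} (h : b ≠ a) (v : Fin n → F) :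
    gAct F n (colMatrix a v) (X b) = X b := by
  rw [gAct_X, ← one_mul (X b), ← C_1, ← linForm_single]
  congr 1
  funext i
  simp [colMatrix, h, Matrix.one_apply, Pi.single_apply]

lemma blkIdx_mono (I : Composition n) : Monotone (blkIdx n I) := fun _ _ h =>
  Finset.card_le_card (Finset.monotone_filter_right _ fun _ _ hi => le_trans hi h)

lemma colMatrix_mem_PIset (I : Composition n) {a : Fin n} {v : Fin n → F} (hv : v a ≠ 0)
    (hv' : ∀ b, a < b → v b = 0) : colMatrix a v ∈ PIset F n I := by
  refine ⟨by rw [det_colMatrix]; exact hv.isUnit, fun i j hij => ?_⟩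
  have hlt : j < i := by
    by_contra hle
    exact absurd (blkIdx_mono I (not_lt.mp hle)) (not_le.mpr hij)
  by_cases hj : j = a
  · subst hj
    simpa [colMatrix] using hv' i hlt
  · simp [colMatrix, hj, hlt.ne']

lemma exists_smul_of_X_dvd_linForm {a : Fin n} {w : Fin n → F}
    (h : (X a : SV F n) ∣ linForm w) : w = w a • Pi.single a 1 := by
  funext b
  by_cases hb : b = a
  · simp [hb]
  · have : modMonomial (linForm w) (Finsupp.single a 1) = 0 := X_dvd_iff_modMonomial_eq_zero.mp h
    have h2 := congrArg (coeff (Finsupp.single b 1)) this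
    rw [coeff_modMonomial_of_not_le, coeff_linForm] at h2
    · simpa [hb] using h2
    · intro hle
      have := hle a
      simp [hb] at this

lemma prime_linForm {v : Fin n → F} (hv : v ≠ 0) : Prime (linForm v) := by
  obtain ⟨a, ha⟩ := Function.ne_iff.mp hv
  rw [← gAct_colMatrix_X a v, ← gActEquiv_apply _ (by
    rw [det_colMatrix]; exact IsUnit.mk0 _ ha), MulEquiv.prime_iff]
  exact X_prime

lemma eq_smul_of_linForm_dvd {v w : Fin n → F} (hv : v ≠ 0) (h : linForm v ∣ linForm w) :
    ∃ c : F, w = c • v := by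
  obtain ⟨a, ha⟩ := Function.ne_iff.mp hv
  have hu : IsUnit (colMatrix a v).det := by
    rw [det_colMatrix]; exact IsUnit.mk0 _ ha
  have hw : w = (colMatrix a v).mulVec ((colMatrix a v)⁻¹.mulVec w) := by
    rw [Matrix.mulVec_mulVec, Matrix.mul_nonsing_inv _ hu, Matrix.one_mulVec]
  rw [← gAct_colMatrix_X a v, hw, ← gAct_linForm, gAct_dvd_iff _ hu] at h
  have h2 := exists_smul_of_X_dvd_linForm h
  refine ⟨((colMatrix a v)⁻¹.mulVec w) a, ?_⟩
  rw [h2, Matrix.mulVec_smul] at hw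
  refine hw.trans (congrArg _ ?_)
  funext i
  simp [colMatrix]

lemma isRelPrime_linForm {s t : Σ a : Fin n, (Fin a → F)} (h : s ≠ t) :
    IsRelPrime (linForm (monicVec s)) (linForm (monicVec t)) := by
  rw [(prime_linForm (monicVec_ne_zero s)).irreducible.isRelPrime_iff_not_dvd]
  intro hd
  obtain ⟨c, hc⟩ := eq_smul_of_linForm_dvd (monicVec_ne_zero s) hd
  exact h (eq_of_monicVec_eq_smul hc).symm

lemma Lm_pow_dvd [Fintype F] {f : SV F n} {m : ℕ}
    (h : ∀ t : (Σ a : Fin n, (Fin a → F)), linForm (monicVec t) ^ m ∣ f) :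
    Lm F n n ^ m ∣ f := by
  rw [Lm_eq, ← Finset.prod_pow]
  exact Fintype.prod_dvd_of_isRelPrime (fun s t hst => (isRelPrime_linForm hst).pow) h

lemma Lm_ne_zero [Fintype F] : Lm F n n ≠ 0 := by
  rw [Lm_eq]
  exact Finset.prod_ne_zero_iff.mpr fun t _ => (prime_linForm (monicVec_ne_zero t)).ne_zero

lemma Lm_dvd_gAct [Fintype F] {g : Matrix (Fin n) (Fin n) F} (hg : IsUnit g.det) :
    Lm F n n ∣ gAct F n g (Lm F n n) := by
  rw [← pow_one (Lm F n n)]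
  refine Lm_pow_dvd fun t => ?_
  rw [pow_one, pow_one]
  set w := g⁻¹.mulVec (monicVec t) with hw
  have hgw : g.mulVec w = monicVec t := by
    rw [hw, Matrix.mulVec_mulVec, Matrix.mul_nonsing_inv _ hg, Matrix.one_mulVec]
  have hw0 : w ≠ 0 := by
    intro h0
    rw [h0, Matrix.mulVec_zero] at hgw
    exact monicVec_ne_zero t hgw.symm
  rw [← hgw, ← gAct_linForm, gAct_dvd_iff _ hg]
  obtain ⟨c, hc, s, hs⟩ := exists_eq_smul_monicVec hw0
  rw [hs, linForm_smul]
  refine (IsUnit.mul_left_dvd ((isUnit_iff_ne_zero.mpr hc).map MvPolynomial.C)).mpr ?_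
  rw [Lm_eq]
  exact Finset.dvd_prod_of_mem _ (mem_univ s)

lemma exists_gAct_Lm [Fintype F] {g : Matrix (Fin n) (Fin n) F} (hg : IsUnit g.det) :
    ∃ u : F, gAct F n g (Lm F n n) = MvPolynomial.C u * Lm F n n := by
  have h1 := Lm_dvd_gAct hg
  have h2 : gAct F n g (Lm F n n) ∣ Lm F n n := by
    have := Lm_dvd_gAct (Matrix.isUnit_nonsing_inv_det _ hg)
    rwa [← gAct_dvd_iff g hg, ← gAct_mul, Matrix.mul_nonsing_inv _ hg, gAct_one] at this
  obtain ⟨u, hu⟩ := associated_of_dvd_dvd h1 h2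
  obtain ⟨r, -, hr⟩ := isUnit_iff_eq_C_of_isReduced.mp u.isUnit
  exact ⟨r, by rw [← hu, hr, mul_comm]⟩

lemma gAct_diagonal_linProd [Fintype F] (d : Fin n → F) (hd : ∀ i, d i ≠ 0) (a : Fin n) :
    gAct F n (Matrix.diagonal d) (linProd F n a a) = MvPolynomial.C (d a) * linProd F n a a := by
  rw [linProd_eq, map_prod]
  let e : (Fin a → F) ≃ (Fin a → F) :=
    Equiv.piCongrRight fun k : Fin a => Equiv.mulLeft₀ ((d a)⁻¹ * d ⟨k, k.2.trans a.2⟩)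
      (mul_ne_zero (inv_ne_zero (hd _)) (hd _))
  have h : ∀ c : Fin a → F, gAct F n (Matrix.diagonal d) (linForm (monicVec ⟨a, c⟩)) =
      MvPolynomial.C (d a) * linForm (monicVec ⟨a, e c⟩) := fun c => by
    rw [gAct_linForm, ← linForm_smul]
    congr 1
    funext k
    simp only [Matrix.mulVec_diagonal, monicVec, Pi.smul_apply, smul_eq_mul, e]
    split_ifs with h1 h2
    · simp [← mul_assoc, hd]
    · simp [h2]
    · simp
  rw [Finset.prod_congr rfl fun c _ => h c, Finset.prod_mul_distrib,
    e.prod_comp fun c => linForm (monicVec ⟨a, c⟩)]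
  rw [Finset.prod_const, Finset.card_univ, Fintype.card_fun, Fintype.card_fin, ← map_pow,
    FiniteField.pow_card_pow]

lemma gAct_transvection_Lm [Fintype F] {i j : Fin n} (hij : i ≠ j) (c : F) :
    gAct F n (Matrix.transvection i j c) (Lm F n n) = Lm F n n := by
  obtain ⟨u, hu⟩ := exists_gAct_Lm (g := Matrix.transvection i j c)
    (by rw [Matrix.det_transvection_of_ne _ _ hij]; exact isUnit_one)
  have h : ∀ m : ℕ, gAct F n (Matrix.transvection i j (m * c)) (Lm F n n) =
      MvPolynomial.C (u ^ m) * Lm F n n := fun m => by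
    induction m with
    | zero => simp [gAct_one]
    | succ m ih =>
      rw [Nat.cast_succ, add_mul, one_mul, ← Matrix.transvection_mul_transvection_same _ _ hij,
        gAct_mul, hu, map_mul, ih, ← algebraMap_eq, AlgHom.commutes, pow_succ, map_mul]
      ring
  have h1 := h (Fintype.card F)
  rw [FiniteField.cast_card_eq_zero, zero_mul, Matrix.transvection_zero, gAct_one,
    FiniteField.pow_card, ← hu] at h1
  exact h1.symm

lemma gAct_Lm [Fintype F] {g : Matrix (Fin n) (Fin n) F} (hg : IsUnit g.det) :
    gAct F n g (Lm F n n) = MvPolynomial.C g.det * Lm F n n := by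
  refine Matrix.diagonal_transvection_induction_of_det_ne_zero
    (fun g => gAct F n g (Lm F n n) = MvPolynomial.C g.det * Lm F n n) g hg.ne_zero
    (fun d hd => ?_) (fun t => ?_) fun A B _ _ hA hB => ?_
  · rw [Matrix.det_diagonal, Finset.prod_ne_zero_iff] at hd
    rw [Matrix.det_diagonal, Lm, map_prod, Finset.prod_range, Finset.prod_range,
      Finset.prod_congr rfl fun a _ => gAct_diagonal_linProd d (fun i => hd i (mem_univ i)) a,
      Finset.prod_mul_distrib, map_prod]
  · rw [Matrix.TransvectionStruct.det, C_1, one_mul]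
    exact gAct_transvection_Lm t.hij t.c
  · rw [gAct_mul, hB, map_mul, hA, ← algebraMap_eq, AlgHom.commutes, Matrix.det_mul, map_mul]
    ring

lemma coeff_gAct_scaling (a : Fin n) (t : F) (f : SV F n) (m : Fin n →₀ ℕ) :
    coeff m (gAct F n (colMatrix a (Pi.single a t)) f) = t ^ m a * coeff m f := by
  induction f using MvPolynomial.induction_on' with
  | monomial u c =>
    have : gAct F n (colMatrix a (Pi.single a t)) (monomial u c) =
        MvPolynomial.C (t ^ u a) * monomial u c := by
      have hX : ∀ i, gAct F n (colMatrix a (Pi.single a t)) (X i) =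
          (if i = a then MvPolynomial.C t else 1) * X i := fun i => by
        split_ifs with hi
        · rw [hi, gAct_colMatrix_X, linForm_single]
        · rw [gAct_colMatrix_X_of_ne hi, one_mul]
      rw [monomial_eq, map_mul, ← algebraMap_eq, AlgHom.commutes, Finsupp.prod_fintype _ _
        (fun _ => pow_zero _), map_prod]
      simp_rw [map_pow, hX, mul_pow]
      rw [Finset.prod_mul_distrib, Finset.prod_eq_single a]
      · simp only [if_true, algebraMap_eq]
        ring
      · intro b _ hb
        simp [hb]
      · simp
    rw [this, coeff_C_mul, coeff_monomial]
    split_ifs with h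
    · rw [h]
    · simp
  | add p q hp hq => rw [map_add, coeff_add, coeff_add, hp, hq, mul_add]

lemma linForm_pow_dvd_of_twisted [Fintype F] {k : ℕ} (hk : 1 ≤ k) (I : Composition n) {f : SV F n}
    (hf : ∀ g ∈ PIset F n I, g.det ^ k • gAct F n g f = f) (t : Σ a : Fin n, (Fin a → F)) :
    linForm (monicVec t) ^ (Fintype.card F - 1 - k) ∣ f := by
  have hX : (X t.1 : SV F n) ^ (Fintype.card F - 1 - k) ∣ f := by
    rw [X_pow_eq_monomial, monomial_one_dvd_iff_modMonomial_eq_zero]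
    ext m
    rw [coeff_zero]
    by_cases hle : Finsupp.single t.1 (Fintype.card F - 1 - k) ≤ m
    · exact coeff_modMonomial_of_le _ hle
    rw [coeff_modMonomial_of_not_le _ hle]
    by_contra hm
    apply hle
    rw [Finsupp.single_le_iff]
    have hdvd : Fintype.card F - 1 ∣ k + m t.1 := by
      rw [← FiniteField.forall_pow_eq_one_iff F]
      intro x
      have hmem : colMatrix t.1 (Pi.single t.1 (x : F)) ∈ PIset F n I :=
        colMatrix_mem_PIset I (by simp) fun b hb => by simp [hb.ne']
      have := congrArg (coeff m) (hf _ hmem)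
      rw [coeff_smul, coeff_gAct_scaling, det_colMatrix, Pi.single_eq_same, smul_eq_mul,
        ← mul_assoc, ← pow_add] at this
      exact Units.ext (by simpa using mul_right_cancel₀ hm (this.trans (one_mul _).symm))
    have := Nat.le_of_dvd (by omega) hdvd
    omega
  have hv : monicVec t t.1 ≠ 0 := by simp [monicVec_self]
  have hmem : colMatrix t.1 (monicVec t) ∈ PIset F n I :=
    colMatrix_mem_PIset I hv fun b hb => monicVec_of_lt t hb
  have hfix := hf _ hmem
  rw [det_colMatrix, monicVec_self, one_pow, one_smul] at hfix
  rw [← gAct_colMatrix_X t.1 (monicVec t), ← map_pow, ← hfix]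
  exact map_dvd _ hX

/-- `∏_c (∑ c_i x_i + y)`, the product over all linear combinations of the first `a` variables. -/
def orbitProd (F : Type) [Field F] [Fintype F] (n a : ℕ) (y : SV F n) : SV F n :=
  ∏ c : Fin a → F, ((∑ k : Fin a, MvPolynomial.C (c k) * xV F n k) + y)

lemma prod_add_algebraMap_mul {K : Type*} [Field K] [Fintype F] [Algebra F K] (y z : K) :
    ∏ t : F, (y + algebraMap F K t * z) =
      y ^ Fintype.card F - z ^ (Fintype.card F - 1) * y := by
  have hq : 1 < Fintype.card F := Fintype.one_lt_card
  by_cases hz : z = 0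
  · have : Fintype.card F - 1 ≠ 0 := by omega
    simp [hz, this]
  have hpoly : (∏ t : F, (Polynomial.X - Polynomial.C t)) =
      (Polynomial.X ^ Fintype.card F - Polynomial.X : Polynomial F) := by
    have := Polynomial.prod_multiset_X_sub_C_of_monic_of_roots_card_eq
      (p := (Polynomial.X ^ Fintype.card F - Polynomial.X : Polynomial F))
      (Polynomial.monic_X_pow_sub (by simpa using hq))
      (by rw [FiniteField.roots_X_pow_card_sub_X,
            FiniteField.X_pow_card_sub_X_natDegree_eq F hq]; rfl)
    rwa [FiniteField.roots_X_pow_card_sub_X] at this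
  have heval := congrArg (Polynomial.aeval (y / z)) hpoly
  simp only [map_prod, map_sub, map_pow, Polynomial.aeval_X, Polynomial.aeval_C] at heval
  have hfac : ∏ t : F, (y + algebraMap F K t * z) = ∏ t : F, (z * (y / z - algebraMap F K t)) := by
    rw [← Equiv.prod_comp (Equiv.neg F)]
    refine Finset.prod_congr rfl fun t _ => ?_
    rw [Equiv.neg_apply, map_neg]
    field_simp
    ring
  rw [hfac, Finset.prod_mul_distrib, heval, Finset.prod_const, Finset.card_univ, mul_sub,
    ← mul_pow, mul_div_cancel₀ _ hz]
  congr 1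
  obtain ⟨m, hm⟩ : ∃ m, Fintype.card F = m + 1 := ⟨Fintype.card F - 1, by omega⟩
  rw [hm, Nat.add_sub_cancel, pow_succ, mul_assoc, mul_div_cancel₀ _ hz]

lemma prod_add_C_mul [Fintype F] (y z : SV F n) :
    ∏ t : F, (y + MvPolynomial.C t * z) =
      y ^ Fintype.card F - z ^ (Fintype.card F - 1) * y := by
  apply IsFractionRing.injective (SV F n) (FractionRing (SV F n))
  simp only [map_prod, map_add, map_sub, map_mul, map_pow, ← algebraMap_eq,
    ← IsScalarTower.algebraMap_apply]
  exact prod_add_algebraMap_mul _ _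

lemma orbitProd_succ [Fintype F] (a : ℕ) (y : SV F n) :
    orbitProd F n (a + 1) y = ∏ t : F, orbitProd F n a (y + MvPolynomial.C t * xV F n a) := by
  rw [orbitProd, ← (Fin.snocEquiv fun _ : Fin (a + 1) => F).prod_comp, Fintype.prod_prod_type]
  refine Finset.prod_congr rfl fun t _ => Finset.prod_congr rfl fun c _ => ?_
  rw [Fin.sum_univ_castSucc]
  simp [Fin.snocEquiv]
  ring

lemma orbitProd_linear [Fintype F] (a : ℕ) :
    (∀ y z : SV F n, orbitProd F n a (y + z) = orbitProd F n a y + orbitProd F n a z) ∧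
    ∀ (c : F) (y : SV F n),
      orbitProd F n a (MvPolynomial.C c * y) = MvPolynomial.C c * orbitProd F n a y := by
  induction a with
  | zero => simp [orbitProd]
  | succ a ih =>
    obtain ⟨hadd, hsmul⟩ := ih
    have key : ∀ y : SV F n, orbitProd F n (a + 1) y = orbitProd F n a y ^ Fintype.card F -
        orbitProd F n a (xV F n a) ^ (Fintype.card F - 1) * orbitProd F n a y := fun y => by
      rw [orbitProd_succ, ← prod_add_C_mul]
      exact Finset.prod_congr rfl fun t _ => by rw [hadd, hsmul]
    refine ⟨fun y z => ?_, fun c y => ?_⟩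
    · have := map_add (FiniteField.frobeniusAlgHom F (SV F n)) (orbitProd F n a y)
        (orbitProd F n a z)
      simp only [FiniteField.frobeniusAlgHom_apply] at this
      rw [key, key, key, hadd, this]
      ring
    · rw [key, key, hsmul, mul_pow, ← map_pow, FiniteField.pow_card]
      ring

lemma orbitProd_add [Fintype F] (m a : ℕ) (y : SV F n) :
    orbitProd F n (m + a) y =
      ∏ c : Fin a → F, orbitProd F n m
        ((∑ k : Fin a, MvPolynomial.C (c k) * xV F n (m + k)) + y) := by
  rw [orbitProd, ← (Fin.appendEquiv m a).prod_comp, Fintype.prod_prod_type, Finset.prod_comm]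
  refine Finset.prod_congr rfl fun t _ => Finset.prod_congr rfl fun c _ => ?_
  rw [Fin.sum_univ_add]
  simp [add_assoc]

lemma orbitProd_sum [Fintype F] (m a : ℕ) (c : Fin a → F) (z : Fin a → SV F n) (y : SV F n) :
    orbitProd F n m ((∑ k, MvPolynomial.C (c k) * z k) + y) =
      (∑ k, MvPolynomial.C (c k) * orbitProd F n m (z k)) + orbitProd F n m y := by
  obtain ⟨hadd, hsmul⟩ := orbitProd_linear (F := F) (n := n) m
  let φ : SV F n →+ SV F n := AddMonoidHom.mk' (orbitProd F n m) hadd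
  rw [hadd]
  congr 1
  exact (map_sum φ _ _).trans (Finset.sum_congr rfl fun k _ => hsmul _ _)

lemma theta_eq [Fintype F] (I : Composition n) (i : Fin I.length) :
    theta F n I i =
      ∏ j : Fin (I.blocksFun i), linProd F n (I.embedding i j) (I.embedding i j) := by
  rw [theta, Lm, map_prod, Finset.prod_range]
  refine Finset.prod_congr rfl fun j _ => ?_
  have hxV : ∀ k : ℕ, k < I.blocksFun i →
      (MvPolynomial.aeval fun t : Fin (I.blocksFun i) => vij F n I i t)
        (xV F (I.blocksFun i) k) =
      orbitProd F n (I.sizeUpTo i) (xV F n (I.sizeUpTo i + k)) := fun k hk => by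
    rw [xV, dif_pos hk, aeval_X]
    rfl
  have hR : linProd F n (I.embedding i j) (I.embedding i j) =
      orbitProd F n (I.sizeUpTo i + j) (xV F n (I.sizeUpTo i + j)) := by
    rw [I.coe_embedding]
    rfl
  rw [hR, orbitProd_add, linProd, map_prod]
  refine Finset.prod_congr rfl fun c _ => ?_
  rw [orbitProd_sum, map_add, map_sum, hxV j j.2]
  congr 1
  refine Finset.sum_congr rfl fun k _ => ?_
  rw [map_mul, hxV k (k.2.trans j.2), ← algebraMap_eq, AlgHom.commutes, algebraMap_eq]

lemma prod_theta [Fintype F] (I : Composition n) :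
    ∏ i : Fin I.length, theta F n I i = Lm F n n := by
  simp_rw [theta_eq]
  rw [I.prod_prod_apply_embedding fun a => linProd F n a a, Lm, Finset.prod_range]

end ParabolicInvariants

/-- **Twisted rank-one invariants** (Wan–Wang, proof of Theorem 3.1, case `j = 0`).
For `1 ≤ k ≤ q−2`, `(S(V) ⊗ Det^k)^{P_I} = (θ_1 θ_2 ⋯ θ_ℓ)^{q−1−k} · S(V)^{P_I}`
is a free `S(V)^{P_I}`-module of rank `1` generated by `(θ_1⋯θ_ℓ)^{q−1−k}`. -/
theorem twisted_symmetric_invariants_rank_one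
    (F : Type) [Field F] [Fintype F] (p r q n k : ℕ)
    (hp : p.Prime) (hr : 0 < r) (hq : q = p ^ r) (hF : Fintype.card F = q)
    (hk1 : 1 ≤ k) (hk2 : k ≤ q - 2)
    (I : Composition n) :
    (∀ f : SV F n,
        (∀ g ∈ PIset F n I, g.det ^ k • gAct F n g f = f) ↔
        ∃ c ∈ invS F n (PIset F n I),
          f = (∏ i : Fin I.length, theta F n I i) ^ (q - 1 - k) * c)
    ∧ (∀ c c' : SV F n,
        (∏ i : Fin I.length, theta F n I i) ^ (q - 1 - k) * c =
          (∏ i : Fin I.length, theta F n I i) ^ (q - 1 - k) * c' → c = c') := by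
  rw [prod_theta]
  have hm0 : Lm F n n ^ (q - 1 - k) ≠ 0 := pow_ne_zero _ Lm_ne_zero
  have htw : ∀ g ∈ PIset F n I, ∀ c : SV F n,
      g.det ^ k • gAct F n g (Lm F n n ^ (q - 1 - k) * c) =
        Lm F n n ^ (q - 1 - k) * gAct F n g c := fun g hg c => by
    have hdet : g.det ^ k * g.det ^ (q - 1 - k) = 1 := by
      rw [← pow_add, Nat.add_sub_cancel' (by omega), ← hF]
      exact FiniteField.pow_card_sub_one_eq_one _ hg.1.ne_zero
    rw [map_mul, map_pow, gAct_Lm hg.1, mul_pow, smul_eq_C_mul, ← map_pow, ← mul_assoc,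
      ← mul_assoc, ← map_mul, hdet, C_1, one_mul]
  refine ⟨fun f => ⟨fun hf => ?_, ?_⟩, fun c c' h => mul_left_cancel₀ hm0 h⟩
  · obtain ⟨c, hc⟩ : Lm F n n ^ (q - 1 - k) ∣ f :=
      Lm_pow_dvd fun t => hF ▸ linForm_pow_dvd_of_twisted hk1 I hf t
    refine ⟨c, fun g hg => mul_left_cancel₀ hm0 ?_, hc⟩
    rw [← htw g hg, ← hc, hf g hg]
  · rintro ⟨c, hc, rfl⟩ g hg
    rw [htw g hg, hc g hg]
end
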